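/- Let s₀, s₁, …, s_{n−1} (n ≥ 1) be bounded transfinite sequences of reals all of the same nonzero length. Then M̄(s₀ ⊕ s₁ ⊕ ⋯ ⊕ s_{n−1}) = (1/n)(M̄(s₀) + M̄(s₁) + ⋯ + M̄(s_{n−1})). -/

import Mathlib

open Ordinal

/-- The number `n` of full blocks in the standard decomposition `o = ω^σ·n + ρ`,
where `ω^σ = ω ^ log ω o` is the largest indecomposable ordinal `≤ o`. -/
noncomputable def stdBlocks (o : Ordinal.{0}) : ℕ :=
  Cardinal.toNat (o / omega0 ^ log omega0 o).card

/-- The upper mean `M̄` of a transfinite sequence of reals.  A sequence of length `o`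
is encoded as a total function `f : Ordinal → ℝ`; only the values of `f` at ordinals
`< o` are ever used.  It is defined by transfinite recursion on `o`:
(1) for `o = 1` it is `f 0`;
(2) for `o` indecomposable with `o > 1` (i.e. `o = ω^σ` with `σ > 0`) it is
    `limsup_{ξ → o} M̄(f|_ξ) = inf_{1 ≤ ζ < o} sup_{ζ ≤ ξ < o} M̄(f|_ξ)`;
(3) for decomposable `o`, writing `o = ω^σ·n + ρ` with `ρ < ω^σ`, it is the average
    `(1/n) (M̄(s₀) + ⋯ + M̄(s_{n-1}))` of the upper means of the `n` consecutive
    blocks of `f` of length `ω^σ` (the remainder of length `ρ` is discarded). -/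
noncomputable def upperMean (o : Ordinal.{0}) (f : Ordinal.{0} → ℝ) : ℝ :=
  if o = 1 then f 0
  else if h1 : 1 < o ∧ o = omega0 ^ log omega0 o then
    ⨅ ζ : Set.Ico (1 : Ordinal.{0}) o, ⨆ ξ : Set.Ico ζ.1 o, upperMean ξ.1 f
  else if h2 : 1 < o then
    ((stdBlocks o : ℝ))⁻¹ *
      ∑ i ∈ Finset.range (stdBlocks o),
        upperMean (omega0 ^ log omega0 o)
          (fun ξ => f (omega0 ^ log omega0 o * (i : Ordinal) + ξ))
  else 0
termination_by o
decreasing_by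
  · exact ξ.2.2
  · exact lt_of_le_of_ne (opow_log_le_self _ (zero_lt_one.trans h2).ne')
      fun h => h1 ⟨h2, h.symm⟩

/-- A transfinite sequence of reals of length `o` is bounded if its range
(on indices `< o`) is bounded in `ℝ`. -/
def SeqBounded (o : Ordinal.{0}) (f : Ordinal.{0} → ℝ) : Prop :=
  ∃ C : ℝ, ∀ ξ < o, |f ξ| ≤ C

/-- The concatenation `r ⊕ s` of a sequence `r` of length `a` with a sequence `s`:
its first `a` entries are those of `r`, and its entry at `a + ξ'` is `s ξ'`. -/
noncomputable def concatSeq (a : Ordinal.{0}) (r s : Ordinal.{0} → ℝ) :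
    Ordinal.{0} → ℝ :=
  fun ξ => if ξ < a then r ξ else s (ξ - a)

/-- An ordinal is indecomposable if it is nonzero and not the sum of two strictly
smaller ordinals. -/
def IsIndecomposable (o : Ordinal.{0}) : Prop :=
  o ≠ 0 ∧ ∀ b < o, ∀ c < o, b + c ≠ o

/-- The concatenation `s₀ ⊕ s₁ ⊕ ⋯ ⊕ s_{n-1}` of `n` sequences, each of length `β`;
the result has length `β * n`. -/
noncomputable def concatN (β : Ordinal.{0}) :
    (n : ℕ) → (Fin n → Ordinal.{0} → ℝ) → Ordinal.{0} → ℝ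
  | 0, _ => fun _ => 0
  | n + 1, s => concatSeq (β * n) (concatN β n (fun i => s i.castSucc)) (s (Fin.last n))

/-- `s / β`: given a sequence `s` whose length is `β * α`, the sequence of length `α`
whose `ι`-th entry is the upper mean of the `ι`-th consecutive block of `s` of
length `β`. -/
noncomputable def seqDiv (s : Ordinal.{0} → ℝ) (β : Ordinal.{0}) : Ordinal.{0} → ℝ :=
  fun ι => upperMean β (fun ξ => s (β * ι + ξ))

/-- The lower mean `𝕄̲(s) = -M̄(-s)`. -/
noncomputable def lowerMean (o : Ordinal.{0}) (s : Ordinal.{0} → ℝ) : ℝ :=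
  - upperMean o (fun ξ => - s ξ)

/-- A sequence `s` of length `o` has mean `c` when its upper and lower means both
equal `c`. -/
def HasMean (o : Ordinal.{0}) (s : Ordinal.{0} → ℝ) (c : ℝ) : Prop :=
  upperMean o s = c ∧ lowerMean o s = c

theorem SeqBounded.shift {o a b : Ordinal.{0}} {f : Ordinal.{0} → ℝ} (hf : SeqBounded o f)
    (h : b + a ≤ o) : SeqBounded a (fun ξ => f (b + ξ)) := by
  obtain ⟨C, hC⟩ := hf
  exact ⟨C, fun ξ hξ => hC _ (((add_lt_add_iff_left b).2 hξ).trans_le h)⟩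

/-- The end of the `i`-th block of length `a` is at most `a * n + ρ` whenever `i < n`. -/
theorem mul_natCast_add_le {a ρ : Ordinal.{0}} {i n : ℕ} (h : i < n) :
    a * (i : Ordinal) + a ≤ a * n + ρ := by
  rw [← mul_add_one]
  refine le_trans ?_ le_self_add
  gcongr
  exact_mod_cast h

theorem exists_eq_opow_log_mul_add {o : Ordinal.{0}} (ho : o ≠ 0) :
    ∃ n : ℕ, 1 ≤ n ∧ ∃ ρ < ω ^ log ω o, o = ω ^ log ω o * n + ρ := by
  obtain ⟨n, hn⟩ := lt_omega0.1 (div_opow_log_lt o one_lt_omega0)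
  refine ⟨n, ?_, o % ω ^ log ω o, mod_lt _ (opow_ne_zero _ omega0_ne_zero), ?_⟩
  · have := div_opow_log_pos ω ho
    rw [hn] at this
    exact_mod_cast this
  · rw [← hn, div_add_mod]

theorem log_opow_mul_natCast_add {σ ρ : Ordinal.{0}} {n : ℕ} (hn : 1 ≤ n) (hρ : ρ < ω ^ σ) :
    log ω (ω ^ σ * n + ρ) = σ := by
  have hn' : (n : Ordinal.{0}) ≠ 0 := by exact_mod_cast (by omega : n ≠ 0)
  rw [log_opow_mul_add one_lt_omega0 hn' hρ, log_eq_zero (natCast_lt_omega0 n), add_zero]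

theorem stdBlocks_opow_mul_add {σ ρ : Ordinal.{0}} {n : ℕ} (hn : 1 ≤ n) (hρ : ρ < ω ^ σ) :
    stdBlocks (ω ^ σ * n + ρ) = n := by
  rw [stdBlocks, log_opow_mul_natCast_add hn hρ,
    mul_add_div _ (opow_ne_zero _ omega0_ne_zero), div_eq_zero_of_lt hρ]
  simp

theorem upperMean_opow_mul_add {σ ρ : Ordinal.{0}} {n : ℕ} (hn : 1 ≤ n) (hρ : ρ < ω ^ σ)
    (f : Ordinal.{0} → ℝ) :
    upperMean (ω ^ σ * n + ρ) f =
      (n : ℝ)⁻¹ *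
        ∑ i ∈ Finset.range n, upperMean (ω ^ σ) (fun ξ => f (ω ^ σ * (i : Ordinal) + ξ)) := by
  have hpos : 1 ≤ (ω ^ σ : Ordinal.{0}) := Order.one_le_iff_pos.2 (opow_pos σ omega0_pos)
  by_cases h : n = 1 ∧ ρ = 0
  · obtain ⟨rfl, rfl⟩ := h
    simp
  · have hlt : ω ^ σ < ω ^ σ * n + ρ := by
      rcases (by omega : n = 1 ∨ 2 ≤ n) with rfl | h2
      · have : ρ ≠ 0 := fun h0 => h ⟨rfl, h0⟩
        simpa using pos_iff_ne_zero.2 this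
      · refine lt_of_lt_of_le ?_ (mul_natCast_add_le (i := 1) (by omega))
        simpa using opow_pos σ omega0_pos
    have h1 : 1 < ω ^ σ * n + ρ := hpos.trans_lt hlt
    rw [upperMean, if_neg h1.ne', log_opow_mul_natCast_add hn hρ, stdBlocks_opow_mul_add hn hρ,
      dif_neg (fun H => hlt.ne' H.2), dif_pos h1]

theorem upperMean_opow {σ : Ordinal.{0}} (hσ : σ ≠ 0) (f : Ordinal.{0} → ℝ) :
    upperMean (ω ^ σ) f =
      ⨅ ζ : Set.Ico (1 : Ordinal.{0}) (ω ^ σ), ⨆ ξ : Set.Ico ζ.1 (ω ^ σ), upperMean ξ.1 f := by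
  have h1 : (1 : Ordinal.{0}) < ω ^ σ := one_lt_opow.2 ⟨one_lt_omega0, hσ⟩
  rw [upperMean, if_neg h1.ne', dif_pos ⟨h1, by rw [log_opow one_lt_omega0]⟩]

theorem upperMean_congr {o : Ordinal.{0}} (ho : o ≠ 0) {f g : Ordinal.{0} → ℝ}
    (h : ∀ ξ < o, f ξ = g ξ) : upperMean o f = upperMean o g := by
  induction o using WellFoundedLT.induction generalizing f g with
  | ind o ih =>
  have hpos : (ω ^ log ω o : Ordinal.{0}) ≠ 0 := opow_ne_zero _ omega0_ne_zero
  obtain ⟨n, hn, ρ, hρ, hdec⟩ := exists_eq_opow_log_mul_add ho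
  rcases (opow_log_le_self ω ho).lt_or_eq with hlt | heq
  · rw [hdec, upperMean_opow_mul_add hn hρ, upperMean_opow_mul_add hn hρ]
    congr 1
    refine Finset.sum_congr rfl fun i hi => ih _ hlt hpos fun ξ hξ => h _ ?_
    refine ((add_lt_add_iff_left _).2 hξ).trans_le ?_
    exact (mul_natCast_add_le (Finset.mem_range.1 hi)).trans hdec.ge
  · by_cases hσ : log ω o = 0
    · rw [hσ, opow_zero] at heq
      subst heq
      rw [upperMean, if_pos rfl, upperMean, if_pos rfl]
      exact h 0 zero_lt_one
    · rw [← heq, upperMean_opow hσ, upperMean_opow hσ, heq]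
      congr! 3 with ζ
      funext ξ
      exact ih _ ξ.2.2 (zero_lt_one.trans_le (ζ.2.1.trans ξ.2.1)).ne'
        fun η hη => h _ (hη.trans ξ.2.2)

theorem iInf_iSup_Ico_le {o : Ordinal.{0}} (ho : 1 < o) {g h : Ordinal.{0} → ℝ} {C : ℝ}
    (hg : ∀ ξ ∈ Set.Ico 1 o, |g ξ| ≤ C) (hh : ∀ ξ ∈ Set.Ico 1 o, |h ξ| ≤ C)
    (hgh : ∀ ε > 0, ∃ ζ ∈ Set.Ico 1 o, ∀ ξ ∈ Set.Ico ζ o, g ξ ≤ h ξ + ε) :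
    ⨅ ζ : Set.Ico (1 : Ordinal.{0}) o, ⨆ ξ : Set.Ico ζ.1 o, g ξ.1 ≤
      ⨅ ζ : Set.Ico (1 : Ordinal.{0}) o, ⨆ ξ : Set.Ico ζ.1 o, h ξ.1 := by
  have bdd : ∀ {k : Ordinal.{0} → ℝ}, (∀ ξ ∈ Set.Ico 1 o, |k ξ| ≤ C) →
      ∀ ζ : Set.Ico (1 : Ordinal.{0}) o, BddAbove (Set.range fun ξ : Set.Ico ζ.1 o => k ξ.1) := by
    rintro k hk ζ
    refine ⟨C, ?_⟩
    rintro _ ⟨ξ, rfl⟩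
    exact (abs_le.1 (hk _ ⟨ζ.2.1.trans ξ.2.1, ξ.2.2⟩)).2
  have : Nonempty (Set.Ico (1 : Ordinal.{0}) o) := ⟨⟨1, le_rfl, ho⟩⟩
  refine le_of_forall_pos_le_add fun ε hε => ?_
  obtain ⟨ζ₀, hζ₀, H⟩ := hgh ε hε
  rw [← sub_le_iff_le_add]
  refine le_ciInf fun ζ => ?_
  rw [sub_le_iff_le_add]
  let ζ' : Set.Ico (1 : Ordinal.{0}) o :=
    ⟨max ζ.1 ζ₀, ζ.2.1.trans (le_max_left _ _), max_lt ζ.2.2 hζ₀.2⟩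
  refine (ciInf_le (f := fun ζ : Set.Ico (1 : Ordinal.{0}) o => ⨆ ξ : Set.Ico ζ.1 o, g ξ.1)
    ⟨-C, ?_⟩ ζ').trans ?_
  · rintro _ ⟨η, rfl⟩
    exact (abs_le.1 (hg _ η.2)).1.trans (le_ciSup (bdd hg η) ⟨η.1, le_rfl, η.2.2⟩)
  · have : Nonempty (Set.Ico ζ'.1 o) := ⟨⟨ζ'.1, le_rfl, ζ'.2.2⟩⟩
    refine ciSup_le fun ξ => ?_
    refine (H ξ.1 ⟨(le_max_right _ _).trans ξ.2.1, ξ.2.2⟩).trans ?_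
    gcongr
    exact le_ciSup (bdd hh ζ) ⟨ξ.1, (le_max_left _ _).trans ξ.2.1, ξ.2.2⟩

theorem abs_iInf_iSup_Ico_le {o : Ordinal.{0}} (ho : 1 < o) {g : Ordinal.{0} → ℝ} {C : ℝ}
    (hg : ∀ ξ ∈ Set.Ico 1 o, |g ξ| ≤ C) :
    |⨅ ζ : Set.Ico (1 : Ordinal.{0}) o, ⨆ ξ : Set.Ico ζ.1 o, g ξ.1| ≤ C := by
  have hC : 0 ≤ C := (abs_nonneg _).trans (hg 1 ⟨le_rfl, ho⟩)
  have : Nonempty (Set.Ico (1 : Ordinal.{0}) o) := ⟨⟨1, le_rfl, ho⟩⟩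
  have hne (ζ : Set.Ico (1 : Ordinal.{0}) o) : Nonempty (Set.Ico ζ.1 o) := ⟨⟨ζ.1, le_rfl, ζ.2.2⟩⟩
  have hconst (c : ℝ) :
      ⨅ ζ : Set.Ico (1 : Ordinal.{0}) o, ⨆ _ : Set.Ico ζ.1 o, c = c := by
    simp only [ciSup_const, ciInf_const]
  have hbound (c : ℝ) (hc : |c| = C) : ∀ ξ ∈ Set.Ico 1 o, |(fun _ : Ordinal.{0} => c) ξ| ≤ C :=
    fun _ _ => hc.le
  refine abs_le.2 ⟨?_, ?_⟩
  · refine (hconst (-C)).ge.trans (iInf_iSup_Ico_le ho (hbound (-C) (by simpa using hC)) hg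
      fun ε hε => ⟨1, ⟨le_rfl, ho⟩, fun ξ hξ => ?_⟩)
    linarith [(abs_le.1 (hg ξ hξ)).1]
  · refine (iInf_iSup_Ico_le ho hg (hbound C (abs_of_nonneg hC))
      fun ε hε => ⟨1, ⟨le_rfl, ho⟩, fun ξ hξ => ?_⟩).trans (hconst C).le
    linarith [(abs_le.1 (hg ξ hξ)).2]

theorem abs_upperMean_le {o : Ordinal.{0}} (ho : o ≠ 0) {f : Ordinal.{0} → ℝ} {C : ℝ}
    (hf : ∀ ξ < o, |f ξ| ≤ C) : |upperMean o f| ≤ C := by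
  induction o using WellFoundedLT.induction generalizing f with
  | ind o ih =>
  have hpos : (ω ^ log ω o : Ordinal.{0}) ≠ 0 := opow_ne_zero _ omega0_ne_zero
  obtain ⟨n, hn, ρ, hρ, hdec⟩ := exists_eq_opow_log_mul_add ho
  rcases (opow_log_le_self ω ho).lt_or_eq with hlt | heq
  · rw [hdec, upperMean_opow_mul_add hn hρ, abs_mul, abs_of_nonneg (by positivity),
      inv_mul_le_iff₀ (Nat.cast_pos.2 hn)]
    refine (Finset.abs_sum_le_sum_abs _ _).trans ?_
    refine (Finset.sum_le_card_nsmul _ _ C fun i hi => ih _ hlt hpos fun ξ hξ => hf _ ?_).trans ?_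
    · refine ((add_lt_add_iff_left _).2 hξ).trans_le ?_
      exact (mul_natCast_add_le (Finset.mem_range.1 hi)).trans hdec.ge
    · simp
  · by_cases hσ : log ω o = 0
    · rw [hσ, opow_zero] at heq
      subst heq
      rw [upperMean, if_pos rfl]
      exact hf 0 zero_lt_one
    · rw [← heq, upperMean_opow hσ, heq]
      have h1 : 1 < o := by
        rw [← heq]
        exact one_lt_opow.2 ⟨one_lt_omega0, hσ⟩
      refine abs_iInf_iSup_Ico_le (g := fun ξ => upperMean ξ f) h1 fun ξ hξ => ?_
      exact ih _ hξ.2 (zero_lt_one.trans_le hξ.1).ne' fun η hη => hf _ (hη.trans hξ.2)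

theorem upperMean_opow_eq_of_eventually_close {σ : Ordinal.{0}} (hσ : σ ≠ 0)
    {f g : Ordinal.{0} → ℝ} (hf : SeqBounded (ω ^ σ) f) (hg : SeqBounded (ω ^ σ) g)
    (hfg : ∀ ε > 0, ∃ ζ ∈ Set.Ico 1 (ω ^ σ), ∀ ξ ∈ Set.Ico ζ (ω ^ σ),
      |upperMean ξ f - upperMean ξ g| ≤ ε) :
    upperMean (ω ^ σ) f = upperMean (ω ^ σ) g := by
  obtain ⟨C, hC⟩ := hf
  obtain ⟨D, hD⟩ := hg
  have h1 : (1 : Ordinal.{0}) < ω ^ σ := one_lt_opow.2 ⟨one_lt_omega0, hσ⟩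
  have hfC : ∀ ξ ∈ Set.Ico 1 (ω ^ σ), |upperMean ξ f| ≤ max C D := fun ξ hξ =>
    abs_upperMean_le (zero_lt_one.trans_le hξ.1).ne'
      fun η hη => (hC _ (hη.trans hξ.2)).trans (le_max_left _ _)
  have hgD : ∀ ξ ∈ Set.Ico 1 (ω ^ σ), |upperMean ξ g| ≤ max C D := fun ξ hξ =>
    abs_upperMean_le (zero_lt_one.trans_le hξ.1).ne'
      fun η hη => (hD _ (hη.trans hξ.2)).trans (le_max_right _ _)
  rw [upperMean_opow hσ, upperMean_opow hσ]
  refine le_antisymm (iInf_iSup_Ico_le h1 hfC hgD fun ε hε => ?_)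
    (iInf_iSup_Ico_le h1 hgD hfC fun ε hε => ?_) <;>
  · obtain ⟨ζ, hζ, H⟩ := hfg ε hε
    refine ⟨ζ, hζ, fun ξ hξ => ?_⟩
    have := abs_le.1 (H ξ hξ)
    linarith

/-- Averages over `n` blocks of length `ω ^ τ` change by at most `2 * C / n` when the first
block is removed. -/
theorem abs_upperMean_opow_shift_sub_le {τ ρ : Ordinal.{0}} {n : ℕ} (hn : 1 ≤ n)
    (hρ : ρ < ω ^ τ) {f : Ordinal.{0} → ℝ} {C : ℝ} (hf : ∀ ξ < ω ^ τ * (n + 1 : ℕ), |f ξ| ≤ C) :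
    |upperMean (ω ^ τ * n + ρ) (fun ξ => f (ω ^ τ + ξ)) - upperMean (ω ^ τ * n + ρ) f| ≤
      2 * C / n := by
  let a : ℕ → ℝ := fun i => upperMean (ω ^ τ) (fun ξ => f (ω ^ τ * (i : Ordinal) + ξ))
  have ha : ∀ i < n + 1, |a i| ≤ C := fun i hi =>
    abs_upperMean_le (opow_ne_zero _ omega0_ne_zero) fun ξ hξ => hf _ <|
      ((add_lt_add_iff_left _).2 hξ).trans_le <| by
        simpa using mul_natCast_add_le (a := ω ^ τ) (ρ := 0) hi
  have hshift (i : ℕ) :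
      upperMean (ω ^ τ) (fun ξ => f (ω ^ τ + (ω ^ τ * (i : Ordinal) + ξ))) = a (i + 1) := by
    simp only [a, ← add_assoc]
    rw [show ((i + 1 : ℕ) : Ordinal.{0}) = 1 + i by rw [add_comm i 1]; push_cast; rfl,
      mul_add, mul_one]
  rw [upperMean_opow_mul_add hn hρ, upperMean_opow_mul_add hn hρ, ← _root_.mul_sub]
  simp only [hshift]
  rw [← Finset.sum_sub_distrib, Finset.sum_range_sub a, abs_mul, abs_of_nonneg (by positivity),
    div_eq_inv_mul]
  gcongr
  have h0 := abs_le.1 (ha 0 (by omega))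
  have h1 := abs_le.1 (ha n (by omega))
  exact abs_le.2 ⟨by linarith, by linarith⟩

/-- The upper mean of a bounded sequence of indecomposable length is unchanged when a proper
initial segment is removed. -/
theorem upperMean_opow_shift {σ ρ : Ordinal.{0}} (hρ : ρ < ω ^ σ) {f : Ordinal.{0} → ℝ}
    (hf : SeqBounded (ω ^ σ) f) :
    upperMean (ω ^ σ) (fun ξ => f (ρ + ξ)) = upperMean (ω ^ σ) f := by
  induction σ using WellFoundedLT.induction generalizing ρ f with
  | ind σ ihσ =>
  have hblock : ∀ τ < σ, ∀ f : Ordinal.{0} → ℝ, SeqBounded (ω ^ σ) f →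
      upperMean (ω ^ σ) (fun ξ => f (ω ^ τ + ξ)) = upperMean (ω ^ σ) f := by
    intro τ hτ f hf
    have hlt : (ω ^ τ : Ordinal.{0}) < ω ^ σ := (opow_lt_opow_iff_right one_lt_omega0).2 hτ
    refine upperMean_opow_eq_of_eventually_close (bot_lt_of_lt hτ).ne'
      (hf.shift (add_omega0_opow hlt).le) hf fun ε hε => ?_
    rcases (Order.add_one_le_of_lt hτ).lt_or_eq with hσ | rfl
    · refine ⟨ω ^ (τ + 1), ⟨Order.one_le_iff_pos.2 (opow_pos _ omega0_pos),
        (opow_lt_opow_iff_right one_lt_omega0).2 hσ⟩, fun ξ hξ => ?_⟩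
      have hξ0 : ξ ≠ 0 := ((opow_pos _ omega0_pos).trans_le hξ.1).ne'
      have hμτ : τ < log ω ξ :=
        Order.add_one_le_iff.1 (le_log_of_opow_le one_lt_omega0 hξ.1)
      have hμσ : log ω ξ < σ := (lt_opow_iff_log_lt one_lt_omega0 hξ0).1 hξ.2
      have hτμ : (ω ^ τ : Ordinal.{0}) < ω ^ log ω ξ :=
        (opow_lt_opow_iff_right one_lt_omega0).2 hμτ
      have hbdd : SeqBounded (ω ^ log ω ξ) f := by
        simpa using hf.shift (b := 0) (a := ω ^ log ω ξ)
          (by simpa using (opow_le_opow_iff_right one_lt_omega0).2 hμσ.le)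
      obtain ⟨n, hn, δ, hδ, hdec⟩ := exists_eq_opow_log_mul_add hξ0
      have heq : upperMean ξ (fun η => f (ω ^ τ + η)) = upperMean ξ f := by
        rw [hdec, upperMean_opow_mul_add hn hδ, upperMean_opow_mul_add hn hδ]
        congr 1
        refine Finset.sum_congr rfl fun i _ => ?_
        rcases Nat.eq_zero_or_pos i with rfl | hi
        · simpa using ihσ _ hμσ hτμ hbdd
        · have habs : ω ^ τ + ω ^ log ω ξ * (i : Ordinal) = ω ^ log ω ξ * (i : Ordinal) :=
            add_of_omega0_opow_le hτμ
              (le_mul_left _ (by exact_mod_cast hi))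
          simp only [← add_assoc, habs]
      rw [heq, _root_.sub_self, abs_zero]
      exact hε.le
    · obtain ⟨C, hC⟩ := hf
      obtain ⟨N, hN⟩ := exists_nat_ge (2 * C / ε)
      have hC0 : 0 ≤ C := (abs_nonneg _).trans (hC 0 (opow_pos _ omega0_pos))
      have hmul (n : ℕ) : (ω ^ τ * n : Ordinal.{0}) < ω ^ (τ + 1) := by
        rw [opow_add, opow_one]
        exact mul_lt_mul_of_pos_left (natCast_lt_omega0 n) (opow_pos _ omega0_pos)
      refine ⟨ω ^ τ * (N + 1 : ℕ), ⟨?_, hmul _⟩, fun ξ hξ => ?_⟩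
      · refine Order.one_le_iff_pos.2 (mul_pos (opow_pos _ omega0_pos) ?_)
        exact_mod_cast N.succ_pos
      · obtain ⟨hle, hξlt⟩ := hξ
        rw [opow_add, opow_one, lt_mul_iff] at hξlt
        obtain ⟨q, hq, r, hr, rfl⟩ := hξlt
        obtain ⟨n, rfl⟩ := lt_omega0.1 hq
        have hNn : N + 1 ≤ n := by
          by_contra! h
          refine hle.not_gt (((add_lt_add_iff_left _).2 hr).trans_le ?_)
          simpa using mul_natCast_add_le (a := ω ^ τ) (ρ := 0) h
        refine (abs_upperMean_opow_shift_sub_le (by omega) hr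
          fun η hη => hC η (hη.trans (hmul _))).trans ?_
        have hn : (N : ℝ) + 1 ≤ n := by exact_mod_cast hNn
        rw [div_le_iff₀ (by linarith [N.cast_nonneg (α := ℝ)])]
        rw [div_le_iff₀ hε] at hN
        nlinarith
  induction ρ using WellFoundedLT.induction generalizing f with
  | ind ρ ihρ =>
  rcases eq_or_ne ρ 0 with rfl | h0
  · simp
  obtain ⟨n, hn, δ, hδ, hdec⟩ := exists_eq_opow_log_mul_add h0
  have hτ : log ω ρ < σ := (lt_opow_iff_log_lt one_lt_omega0 h0).1 hρ
  have hτσ : (ω ^ log ω ρ : Ordinal.{0}) < ω ^ σ := (opow_lt_opow_iff_right one_lt_omega0).2 hτ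
  have hmul : ∀ (m : ℕ) (g : Ordinal.{0} → ℝ), SeqBounded (ω ^ σ) g →
      upperMean (ω ^ σ) (fun ξ => g (ω ^ log ω ρ * m + ξ)) = upperMean (ω ^ σ) g := by
    intro m
    induction m with
    | zero => simp
    | succ m ih =>
      intro g hg
      have := ih (fun ξ => g (ω ^ log ω ρ + ξ)) (hg.shift (add_omega0_opow hτσ).le)
      rw [← hblock _ hτ g hg, ← this]
      rw [add_comm m 1]
      push_cast
      simp only [mul_add, mul_one, add_assoc]
  have hmlt : ω ^ log ω ρ * n < ω ^ σ := (le_self_add.trans hdec.ge).trans_lt hρ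
  have hδρ : δ < ρ := hδ.trans_le (opow_log_le_self ω h0)
  rw [← hmul n f hf, ← ihρ δ hδρ (hδρ.trans hρ) (hf.shift (add_omega0_opow hmlt).le)]
  simp only [← add_assoc, ← hdec]

theorem upperMean_mul_natCast {n : ℕ} (hn : 1 ≤ n) {β : Ordinal.{0}} (hβ : β ≠ 0)
    {f : Ordinal.{0} → ℝ} (hf : SeqBounded (β * n) f) :
    upperMean (β * n) f =
      (n : ℝ)⁻¹ * ∑ i ∈ Finset.range n, upperMean β (fun ξ => f (β * (i : Ordinal) + ξ)) := by
  obtain ⟨k, hk, ρ, hρ, hdec⟩ := exists_eq_opow_log_mul_add hβ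
  generalize log ω β = σ at *
  have hρk : ρ + ω ^ σ * (k : Ordinal) = ω ^ σ * (k : Ordinal) :=
    add_of_omega0_opow_le hρ (le_mul_left _ (by exact_mod_cast hk))
  have hmul (i : ℕ) : β * ((i + 1 : ℕ) : Ordinal) = ω ^ σ * ((k * (i + 1) : ℕ) : Ordinal) + ρ := by
    rw [hdec]
    push_cast
    rw [add_mul_add_one _ hρk, mul_assoc]
  obtain ⟨m, rfl⟩ := Nat.exists_eq_add_of_le' hn
  have hsum : ∀ i ∈ Finset.range (m + 1), upperMean β (fun ξ => f (β * (i : Ordinal) + ξ)) =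
      (k : ℝ)⁻¹ * ∑ l ∈ Finset.range k,
        upperMean (ω ^ σ) (fun ξ => f (ω ^ σ * ((k * i + l : ℕ) : Ordinal) + ξ)) := by
    intro i hi
    conv_lhs => rw [hdec]
    rw [upperMean_opow_mul_add hk hρ]
    congr 1
    refine Finset.sum_congr rfl fun l hl => ?_
    rw [← hdec]
    rcases i with _ | i
    · simp
    have hbdd : SeqBounded (ω ^ σ) (fun ξ => f (ω ^ σ * ((k * (i + 1) + l : ℕ) : Ordinal) + ξ)) := by
      refine hf.shift ?_
      rw [hmul]
      refine mul_natCast_add_le ?_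
      have := Finset.mem_range.1 hl
      have := Finset.mem_range.1 hi
      nlinarith
    rcases Nat.eq_zero_or_pos l with rfl | hl0
    · rw [← upperMean_opow_shift hρ hbdd]
      simp only [hmul, add_zero, add_assoc, Nat.cast_zero, mul_zero, zero_add]
    · have : ρ + ω ^ σ * (l : Ordinal) = ω ^ σ * (l : Ordinal) :=
        add_of_omega0_opow_le hρ (le_mul_left _ (by exact_mod_cast hl0))
      simp only [hmul, ← add_assoc]
      rw [add_assoc _ ρ, this, ← mul_add, ← Nat.cast_add]
  have hblocks (a : ℕ → ℝ) (j : ℕ) : ∑ i ∈ Finset.range j, ∑ l ∈ Finset.range k, a (k * i + l) =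
      ∑ i ∈ Finset.range (k * j), a i := by
    induction j with
    | zero => simp
    | succ j ih => rw [Finset.sum_range_succ, ih, Nat.mul_succ, Finset.sum_range_add]
  rw [Finset.sum_congr rfl hsum, ← Finset.mul_sum, hblocks fun j =>
    upperMean (ω ^ σ) (fun ξ => f (ω ^ σ * (j : Ordinal) + ξ)), hmul,
    upperMean_opow_mul_add (Nat.mul_pos hk m.succ_pos) hρ, ← mul_assoc, Nat.cast_mul, mul_inv,
    mul_comm (k : ℝ)⁻¹]

theorem concatN_apply {β : Ordinal.{0}} {n : ℕ} (s : Fin n → Ordinal.{0} → ℝ) (i : Fin n)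
    {ξ : Ordinal.{0}} (hξ : ξ < β) : concatN β n s (β * (i : ℕ) + ξ) = s i ξ := by
  induction n with
  | zero => exact i.elim0
  | succ n ih =>
    rw [concatN, concatSeq]
    induction i using Fin.lastCases with
    | last => simp
    | cast i =>
      have hlt : β * (i : ℕ) + ξ < β * n := by
        refine ((add_lt_add_iff_left _).2 hξ).trans_le ?_
        simpa using mul_natCast_add_le (a := β) (ρ := 0) i.2
      rw [Fin.val_castSucc, if_pos hlt, ih]

theorem SeqBounded.concatN {β : Ordinal.{0}} {n : ℕ} {s : Fin n → Ordinal.{0} → ℝ}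
    (hs : ∀ i, SeqBounded β (s i)) : SeqBounded (β * n) (concatN β n s) := by
  choose C hC using hs
  refine ⟨∑ i, |C i|, fun ξ hξ => ?_⟩
  obtain ⟨q, hq, r, hr, rfl⟩ := lt_mul_iff.1 hξ
  obtain ⟨i, rfl⟩ := lt_omega0.1 (hq.trans (natCast_lt_omega0 n))
  have hi : i < n := by exact_mod_cast hq
  rw [concatN_apply s ⟨i, hi⟩ hr]
  exact ((hC ⟨i, hi⟩ r hr).trans (le_abs_self _)).trans
    (Finset.single_le_sum (f := fun i => |C i|) (fun j _ => abs_nonneg _) (Finset.mem_univ _))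

/-- The upper mean of the concatenation `s₀ ⊕ ⋯ ⊕ s_{n-1}` of
`n ≥ 1` bounded sequences of the same nonzero length `β` is the arithmetic mean
`(1/n)(M̄(s₀) + ⋯ + M̄(s_{n-1}))`. -/
theorem upperMean_concatN (n : ℕ) (hn : 1 ≤ n) (β : Ordinal.{0}) (hβ : β ≠ 0)
    (s : Fin n → Ordinal.{0} → ℝ) (hs : ∀ i, SeqBounded β (s i)) :
    upperMean (β * n) (concatN β n s) = (n : ℝ)⁻¹ * ∑ i, upperMean β (s i) := by
  rw [upperMean_mul_natCast hn hβ (SeqBounded.concatN hs), Finset.sum_range]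
  congr 1
  exact Finset.sum_congr rfl fun i _ => upperMean_congr hβ fun ξ hξ => concatN_apply s i hξ
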